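/- Let 𝓗 be an infinite-dimensional complex Hilbert space and let 𝓡_f(𝓗) be the set of regular (i.e. closable) elements of 𝓥_f(𝓗). Then (𝓡_f(𝓗); ⊕|_{𝓡_f(𝓗)}, o) is a generalized effect algebra; in particular, if t, s ∈ 𝓡_f(𝓗) and t ⊕ s is defined in 𝓥_f(𝓗), then t ⊕ s is closable, so t ⊕|_{𝓡_f(𝓗)} s is defined. -/

import Mathlib

set_option autoImplicit false

noncomputable section

open Filter

variable {H : Type*}

/-- A densely defined positive bilinear (sesquilinear) form on a complex Hilbert space `H`:
it is given by a dense domain `dom` and a map `toFun : H → H → ℂ` which is linear in the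
first argument and conjugate-linear in the second one on the domain, takes real nonnegative
values on the diagonal of the domain, and (as a normalization) vanishes off the domain. -/
structure PBF (H : Type*) [NormedAddCommGroup H] [InnerProductSpace ℂ H] where
  dom : Submodule ℂ H
  dense' : Dense (dom : Set H)
  toFun : H → H → ℂ
  zero_off : ∀ x y : H, x ∉ dom ∨ y ∉ dom → toFun x y = 0
  add_left : ∀ x y z : H, x ∈ dom → y ∈ dom → z ∈ dom →
    toFun (x + y) z = toFun x z + toFun y z
  smul_left : ∀ (c : ℂ) (x y : H), x ∈ dom → y ∈ dom →
    toFun (c • x) y = c * toFun x y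
  add_right : ∀ x y z : H, x ∈ dom → y ∈ dom → z ∈ dom →
    toFun x (y + z) = toFun x y + toFun x z
  smul_right : ∀ (c : ℂ) (x y : H), x ∈ dom → y ∈ dom →
    toFun x (c • y) = (starRingEnd ℂ) c * toFun x y
  re_nonneg : ∀ x : H, x ∈ dom → 0 ≤ (toFun x x).re
  im_zero : ∀ x : H, x ∈ dom → (toFun x x).im = 0

variable [NormedAddCommGroup H] [InnerProductSpace ℂ H]

namespace PBF

/-- A positive bilinear form is bounded if `sup {t(x,x) : x ∈ D(t), ‖x‖ = 1} < ∞`. -/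
def Bounded (t : PBF H) : Prop :=
  ∃ c : ℝ, ∀ x ∈ t.dom, (t.toFun x x).re ≤ c * ‖x‖ ^ 2

/-- Membership in `𝓥_f(𝓗)`: a positive bilinear form whose domain is all of `H`
whenever the form is bounded. -/
def InVf (t : PBF H) : Prop := t.Bounded → t.dom = ⊤

/-- `u` is the usual sum `t + s`, with domain `D(t) ⊓ D(s)`. -/
def IsSum (t s u : PBF H) : Prop :=
  u.dom = t.dom ⊓ s.dom ∧
  ∀ x y : H, x ∈ u.dom → y ∈ u.dom → u.toFun x y = t.toFun x y + s.toFun x y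

/-- Definedness of the partial operation `⊕` on `𝓥_f(𝓗)`:
`t ⊕ s` is defined iff `t` or `s` is bounded, or `D(t) = D(s)`. -/
def OplusDef (t s : PBF H) : Prop := t.Bounded ∨ s.Bounded ∨ t.dom = s.dom

/-- `t ⊕ s = u` in `𝓥_f(𝓗)`. -/
def Oplus (t s u : PBF H) : Prop := OplusDef t s ∧ IsSum t s u

/-- The squared norm `‖x‖_t² = t(x,x) + ‖x‖²` associated with the inner product
`(x,y)_t := t(x,y) + (x,y)` on `D(t)`. -/
def q (t : PBF H) (x : H) : ℝ := (t.toFun x x).re + ‖x‖ ^ 2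

/-- `t` is closed: `D(t)` is complete under the inner product `(x,y)_t := t(x,y) + (x,y)`
(sequential formulation of completeness). -/
def IsClosedForm (t : PBF H) : Prop :=
  ∀ f : ℕ → H, (∀ n, f n ∈ t.dom) →
    (∀ ε : ℝ, 0 < ε → ∃ N : ℕ, ∀ m ≥ N, ∀ n ≥ N, t.q (f m - f n) < ε) →
    ∃ x ∈ t.dom, Tendsto (fun n => t.q (f n - x)) atTop (nhds 0)

/-- `s` is an extension of `t` (i.e. `s|_{D(t)} = t`). -/
def Extends (s t : PBF H) : Prop :=
  t.dom ≤ s.dom ∧ ∀ x y : H, x ∈ t.dom → y ∈ t.dom → s.toFun x y = t.toFun x y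

/-- `t` is closable (equivalently, regular) iff it has a closed extension. -/
def Closable (t : PBF H) : Prop := ∃ s : PBF H, s.IsClosedForm ∧ s.Extends t

/-- `t` is singular: the only closable positive bilinear form `r` with `D(r) = D(t)` and
`r(x,x) ≤ t(x,x)` on `D(t)` is the zero form. -/
def Singular (t : PBF H) : Prop :=
  ∀ r : PBF H, r.Closable → r.dom = t.dom →
    (∀ x ∈ t.dom, (r.toFun x x).re ≤ (t.toFun x x).re) →
    ∀ x y : H, r.toFun x y = 0

/-- `tr` is the regular part of `t`: the largest closable positive bilinear form `r` with
`D(r) = D(t)` and `r(x,x) ≤ t(x,x)` for all `x ∈ D(t)` (Simon's decomposition theorem). -/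
def IsRegularPart (t tr : PBF H) : Prop :=
  tr.Closable ∧ tr.dom = t.dom ∧
  (∀ x ∈ t.dom, (tr.toFun x x).re ≤ (t.toFun x x).re) ∧
  ∀ r : PBF H, r.Closable → r.dom = t.dom →
    (∀ x ∈ t.dom, (r.toFun x x).re ≤ (t.toFun x x).re) →
    ∀ x ∈ t.dom, (r.toFun x x).re ≤ (tr.toFun x x).re

end PBF

/-- The zero form `o`, with `D(o) = 𝓗`. -/
def zeroPBF (H : Type*) [NormedAddCommGroup H] [InnerProductSpace ℂ H] : PBF H where
  dom := ⊤
  dense' := by rw [Submodule.top_coe]; exact dense_univ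
  toFun := fun _ _ => 0
  zero_off := fun _ _ _ => rfl
  add_left := by intros; simp
  smul_left := by intros; simp
  add_right := by intros; simp
  smul_right := by intros; simp
  re_nonneg := by intros; simp
  im_zero := by intros; simp

/-- `Q` is (the carrier of) a sub-generalized effect algebra of `(𝓥_f(𝓗); ⊕, o)`:
it contains `o`, and whenever `x ⊕ y = z` in `𝓥_f(𝓗)` with at least two of `x, y, z`
in `Q`, then all three are in `Q`. -/
def SubGEACond (Q : PBF H → Prop) : Prop :=
  Q (zeroPBF H) ∧
  ∀ x y z : PBF H, x.InVf → y.InVf → z.InVf → PBF.Oplus x y z →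
    ((Q x ∧ Q y) ∨ (Q x ∧ Q z) ∨ (Q y ∧ Q z)) → (Q x ∧ Q y ∧ Q z)

/-- Membership in the generalized effect algebra carried by `{t ∈ 𝓥_f(𝓗) : Q t}`. -/
def MemAlg (Q : PBF H → Prop) (t : PBF H) : Prop := t.InVf ∧ Q t

/-- The order induced by the restricted operation `⊕|_Q` on `{t ∈ 𝓥_f(𝓗) : Q t}`:
`s ≤ t` iff `s ⊕ r = t` for some `r` in the algebra. -/
def leQ (Q : PBF H → Prop) (s t : PBF H) : Prop :=
  ∃ r : PBF H, MemAlg Q r ∧ PBF.Oplus s r t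

/-- The order induced by `⊕` on `𝓥_f(𝓗)`: `s ≤ t` iff `s ⊕ r = t` for some `r ∈ 𝓥_f(𝓗)`. -/
def leVf (s t : PBF H) : Prop := ∃ r : PBF H, r.InVf ∧ PBF.Oplus s r t

/-- The algebra `{t ∈ 𝓥_f(𝓗) : Q t}` is monotone Dedekind upwards σ-complete: every
non-decreasing sequence dominated by some element has a supremum (w.r.t. the induced order). -/
def UpSigmaQ (Q : PBF H → Prop) : Prop :=
  ∀ f : ℕ → PBF H, (∀ n, MemAlg Q (f n)) → (∀ n, leQ Q (f n) (f (n + 1))) →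
    (∃ b : PBF H, MemAlg Q b ∧ ∀ n, leQ Q (f n) b) →
    ∃ s : PBF H, MemAlg Q s ∧ (∀ n, leQ Q (f n) s) ∧
      ∀ z : PBF H, MemAlg Q z → (∀ n, leQ Q (f n) z) → leQ Q s z

/-- The algebra `{t ∈ 𝓥_f(𝓗) : Q t}` is monotone Dedekind downwards σ-complete: every
non-increasing sequence has an infimum (w.r.t. the induced order). -/
def DownSigmaQ (Q : PBF H → Prop) : Prop :=
  ∀ f : ℕ → PBF H, (∀ n, MemAlg Q (f n)) → (∀ n, leQ Q (f (n + 1)) (f n)) →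
    ∃ i : PBF H, MemAlg Q i ∧ (∀ n, leQ Q i (f n)) ∧
      ∀ z : PBF H, MemAlg Q z → (∀ n, leQ Q z (f n)) → leQ Q z i

namespace PBF

theorem ext_on_dom {t s : PBF H} (hd : t.dom = s.dom)
    (h : ∀ x ∈ t.dom, ∀ y ∈ t.dom, t.toFun x y = s.toFun x y) : t = s := by
  have hf : t.toFun = s.toFun := by
    funext x y
    by_cases hxy : x ∈ t.dom ∧ y ∈ t.dom
    · exact h x hxy.1 y hxy.2
    · rw [not_and_or] at hxy
      rw [t.zero_off x y hxy, s.zero_off x y (hd ▸ hxy)]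
  cases t
  cases s
  cases hd
  cases hf
  rfl

theorem conj_symm (t : PBF H) {x y : H} (hx : x ∈ t.dom) (hy : y ∈ t.dom) :
    (starRingEnd ℂ) (t.toFun y x) = t.toFun x y := by
  have hiy : Complex.I • y ∈ t.dom := t.dom.smul_mem _ hy
  have h1 := t.im_zero (x + y) (t.dom.add_mem hx hy)
  have h2 := t.im_zero (x + Complex.I • y) (t.dom.add_mem hx hiy)
  rw [t.add_left x y _ hx hy (t.dom.add_mem hx hy), t.add_right x x y hx hx hy,
    t.add_right y x y hy hx hy] at h1
  rw [t.add_left x _ _ hx hiy (t.dom.add_mem hx hiy), t.add_right x x _ hx hx hiy,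
    t.add_right _ x _ hiy hx hiy, t.smul_right _ x y hx hy, t.smul_left _ y x hy hx,
    t.smul_left _ y _ hy hiy, t.smul_right _ y y hy hy] at h2
  have hx0 := t.im_zero x hx
  have hy0 := t.im_zero y hy
  apply Complex.ext
  · simp at h2 ⊢
    linarith
  · simp at h1 ⊢
    linarith

/-- The pre-inner product on the domain of a positive form; Mathlib's inner products are
conjugate-linear in the first argument, hence the swap. -/
abbrev preInnerCore (t : PBF H) : PreInnerProductSpace.Core ℂ t.dom where
  inner x y := t.toFun y x
  conj_inner_symm x y := t.conj_symm y.2 x.2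
  re_inner_nonneg x := t.re_nonneg x x.2
  add_left x y z := t.add_right z x y z.2 x.2 y.2
  smul_left x y c := t.smul_right c y x y.2 x.2

theorem norm_sq_le (t : PBF H) {x y : H} (hx : x ∈ t.dom) (hy : y ∈ t.dom) :
    ‖t.toFun x y‖ ^ 2 ≤ (t.toFun x x).re * (t.toFun y y).re := by
  have h := @InnerProductSpace.Core.inner_mul_inner_self_le ℂ t.dom _ _ _ t.preInnerCore
    ⟨x, hx⟩ ⟨y, hy⟩
  change ‖t.toFun y x‖ * ‖t.toFun x y‖ ≤ (t.toFun x x).re * (t.toFun y y).re at h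
  rwa [← t.conj_symm hy hx, RCLike.norm_conj, ← pow_two] at h

theorem continuous_left {t : PBF H} (hb : t.Bounded) (hd : t.dom = ⊤) (y : H) :
    Continuous fun x => t.toFun x y := by
  have hm : ∀ x, x ∈ t.dom := fun x => hd ▸ Submodule.mem_top
  obtain ⟨c, hc⟩ := hb
  let f : H →ₗ[ℂ] ℂ :=
    { toFun := fun x => t.toFun x y
      map_add' := fun a b => t.add_left a b y (hm a) (hm b) (hm y)
      map_smul' := fun a b => t.smul_left a b y (hm b) (hm y) }
  refine AddMonoidHomClass.continuous_of_bound f √(c * (t.toFun y y).re) fun x => ?_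
  change ‖t.toFun x y‖ ≤ _
  rw [← Real.sqrt_sq (norm_nonneg x), ← Real.sqrt_mul' _ (sq_nonneg _)]
  apply Real.le_sqrt_of_sq_le
  calc ‖t.toFun x y‖ ^ 2 ≤ (t.toFun x x).re * (t.toFun y y).re := t.norm_sq_le (hm x) (hm y)
    _ ≤ (c * ‖x‖ ^ 2) * (t.toFun y y).re := by
        gcongr
        · exact t.re_nonneg y (hm y)
        · exact hc x (hm x)
    _ = _ := by ring

theorem eq_of_bounded_of_eqOn_dense {t s : PBF H} (ht : t.Bounded) (hs : s.Bounded)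
    (htd : t.dom = ⊤) (hsd : s.dom = ⊤) {E : Set H} (hE : Dense E)
    (h : ∀ x ∈ E, ∀ y ∈ E, t.toFun x y = s.toFun x y) : t = s := by
  have htm : ∀ x, x ∈ t.dom := fun x => htd ▸ Submodule.mem_top
  have hsm : ∀ x, x ∈ s.dom := fun x => hsd ▸ Submodule.mem_top
  have key : ∀ y ∈ E, ∀ x, t.toFun x y = s.toFun x y := fun y hy =>
    congrFun ((continuous_left ht htd y).ext_on hE (continuous_left hs hsd y)
      fun x hx => h x hx y hy)
  refine ext_on_dom (htd.trans hsd.symm) fun x _ y _ => ?_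
  refine congrFun ((continuous_left ht htd y).ext_on hE (continuous_left hs hsd y)
    fun a ha => ?_) x
  change t.toFun a y = s.toFun a y
  rw [← t.conj_symm (htm a) (htm y), ← s.conj_symm (hsm a) (hsm y), key a ha y]

open Classical in
/-- The sum of two positive forms, when the intersection of their domains is dense. -/
def sum (t s : PBF H) (hd : Dense ((t.dom ⊓ s.dom : Submodule ℂ H) : Set H)) : PBF H where
  dom := t.dom ⊓ s.dom
  dense' := hd
  toFun x y := if x ∈ t.dom ⊓ s.dom ∧ y ∈ t.dom ⊓ s.dom then t.toFun x y + s.toFun x y else 0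
  zero_off x y h := if_neg (by tauto)
  add_left x y z hx hy hz := by
    rw [if_pos ⟨add_mem hx hy, hz⟩, if_pos ⟨hx, hz⟩, if_pos ⟨hy, hz⟩,
      t.add_left x y z hx.1 hy.1 hz.1, s.add_left x y z hx.2 hy.2 hz.2]
    ring
  smul_left c x y hx hy := by
    rw [if_pos ⟨Submodule.smul_mem _ c hx, hy⟩, if_pos ⟨hx, hy⟩,
      t.smul_left c x y hx.1 hy.1, s.smul_left c x y hx.2 hy.2]
    ring
  add_right x y z hx hy hz := by
    rw [if_pos ⟨hx, add_mem hy hz⟩, if_pos ⟨hx, hy⟩, if_pos ⟨hx, hz⟩,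
      t.add_right x y z hx.1 hy.1 hz.1, s.add_right x y z hx.2 hy.2 hz.2]
    ring
  smul_right c x y hx hy := by
    rw [if_pos ⟨hx, Submodule.smul_mem _ c hy⟩, if_pos ⟨hx, hy⟩,
      t.smul_right c x y hx.1 hy.1, s.smul_right c x y hx.2 hy.2]
    ring
  re_nonneg x hx := by
    rw [if_pos ⟨hx, hx⟩, Complex.add_re]
    exact add_nonneg (t.re_nonneg x hx.1) (s.re_nonneg x hx.2)
  im_zero x hx := by
    rw [if_pos ⟨hx, hx⟩, Complex.add_im, t.im_zero x hx.1, s.im_zero x hx.2, add_zero]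

theorem isSum_sum (t s : PBF H) (hd : Dense ((t.dom ⊓ s.dom : Submodule ℂ H) : Set H)) :
    IsSum t s (t.sum s hd) :=
  ⟨rfl, fun _ _ hx hy => if_pos ⟨hx, hy⟩⟩

theorem IsSum.symm {t s u : PBF H} (h : IsSum t s u) : IsSum s t u :=
  ⟨h.1.trans (inf_comm _ _), fun x y hx hy => (h.2 x y hx hy).trans (add_comm _ _)⟩

theorem IsSum.mem_left {t s u : PBF H} (h : IsSum t s u) {x : H} (hx : x ∈ u.dom) :
    x ∈ t.dom := (h.1 ▸ hx : x ∈ t.dom ⊓ s.dom).1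

theorem IsSum.unique {t s u v : PBF H} (hu : IsSum t s u) (hv : IsSum t s v) : u = v := by
  have hd : u.dom = v.dom := hu.1.trans hv.1.symm
  refine ext_on_dom hd fun x hx y hy => ?_
  rw [hu.2 x y hx hy, hv.2 x y (hd ▸ hx) (hd ▸ hy)]

theorem OplusDef.symm {t s : PBF H} (h : OplusDef t s) : OplusDef s t := by
  rcases h with h | h | h
  exacts [.inr (.inl h), .inl h, .inr (.inr h.symm)]

theorem IsSum.bounded {t s u : PBF H} (h : IsSum t s u) (ht : t.Bounded) (hs : s.Bounded) :
    u.Bounded := by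
  obtain ⟨c, hc⟩ := ht
  obtain ⟨d, hd⟩ := hs
  refine ⟨c + d, fun x hx => ?_⟩
  rw [h.2 x x hx hx, Complex.add_re, add_mul]
  exact add_le_add (hc x (h.mem_left hx)) (hd x (h.symm.mem_left hx))

theorem IsSum.bounded_left {t s u : PBF H} (h : IsSum t s u) (hu : u.Bounded)
    (hle : t.dom ≤ s.dom) : t.Bounded := by
  obtain ⟨c, hc⟩ := hu
  refine ⟨c, fun x hx => ?_⟩
  have hxu : x ∈ u.dom := by
    rw [h.1]
    exact ⟨hx, hle hx⟩
  have := hc x hxu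
  rw [h.2 x x hxu hxu, Complex.add_re] at this
  linarith [s.re_nonneg x (hle hx)]

theorem IsSum.inVf_of_le {t s u : PBF H} (h : IsSum t s u) (ht : t.InVf)
    (hle : t.dom ≤ s.dom) : u.InVf := fun hu => by
  rw [h.1, inf_eq_left.2 hle]
  exact ht (h.bounded_left hu hle)

theorem OplusDef.dom_le {t s : PBF H} (ht : t.InVf) (hs : s.InVf) (h : OplusDef t s) :
    t.dom ≤ s.dom ∨ s.dom ≤ t.dom := by
  rcases h with h | h | h
  · exact .inr (ht h ▸ le_top)
  · exact .inl (hs h ▸ le_top)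
  · exact .inl h.le

theorem IsSum.inVf {t s u : PBF H} (h : IsSum t s u) (hd : OplusDef t s) (ht : t.InVf)
    (hs : s.InVf) : u.InVf := by
  rcases hd.dom_le ht hs with hle | hle
  exacts [h.inVf_of_le ht hle, h.symm.inVf_of_le hs hle]

theorem OplusDef.dense_inf {t s : PBF H} (ht : t.InVf) (hs : s.InVf) (h : OplusDef t s) :
    Dense ((t.dom ⊓ s.dom : Submodule ℂ H) : Set H) := by
  rcases h.dom_le ht hs with hle | hle
  · rw [inf_eq_left.2 hle]
    exact t.dense'
  · rw [inf_eq_right.2 hle]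
    exact s.dense'

theorem norm_sq_le_q (t : PBF H) {x : H} (hx : x ∈ t.dom) : ‖x‖ ^ 2 ≤ t.q x :=
  le_add_of_nonneg_left (t.re_nonneg x hx)

theorem tendsto_of_q_tendsto (t : PBF H) {f : ℕ → H} {x : H} (hf : ∀ n, f n ∈ t.dom)
    (hx : x ∈ t.dom) (h : Tendsto (fun n => t.q (f n - x)) atTop (nhds 0)) :
    Tendsto f atTop (nhds x) := by
  rw [tendsto_iff_norm_sub_tendsto_zero]
  have h2 : Tendsto (fun n => ‖f n - x‖ ^ 2) atTop (nhds 0) :=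
    squeeze_zero (fun _ => sq_nonneg _)
      (fun n => t.norm_sq_le_q (t.dom.sub_mem (hf n) hx)) h
  simpa using h2.sqrt

theorem IsSum.q_eq {t s u : PBF H} (h : IsSum t s u) {x : H} (hx : x ∈ u.dom) :
    u.q x = t.q x + s.q x - ‖x‖ ^ 2 := by
  rw [q, q, q, h.2 x x hx hx, Complex.add_re]
  ring

theorem IsSum.q_le {t s u : PBF H} (h : IsSum t s u) {x : H} (hx : x ∈ u.dom) :
    t.q x ≤ u.q x := by
  linarith [h.q_eq hx, s.norm_sq_le_q (h.symm.mem_left hx)]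

theorem IsSum.isClosedForm {t s u : PBF H} (h : IsSum t s u) (ht : t.IsClosedForm)
    (hs : s.IsClosedForm) : u.IsClosedForm := by
  intro f hf hc
  have hsub : ∀ m n, f m - f n ∈ u.dom := fun m n => u.dom.sub_mem (hf m) (hf n)
  obtain ⟨x, hx, hxt⟩ := ht f (fun n => h.mem_left (hf n)) fun ε hε => by
    obtain ⟨N, hN⟩ := hc ε hε
    exact ⟨N, fun m hm n hn => (h.q_le (hsub m n)).trans_lt (hN m hm n hn)⟩
  obtain ⟨y, hy, hys⟩ := hs f (fun n => h.symm.mem_left (hf n)) fun ε hε => by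
    obtain ⟨N, hN⟩ := hc ε hε
    exact ⟨N, fun m hm n hn => (h.symm.q_le (hsub m n)).trans_lt (hN m hm n hn)⟩
  have hfx := t.tendsto_of_q_tendsto (fun n => h.mem_left (hf n)) hx hxt
  obtain rfl : x = y := tendsto_nhds_unique hfx
    (s.tendsto_of_q_tendsto (fun n => h.symm.mem_left (hf n)) hy hys)
  have hxu : x ∈ u.dom := by
    rw [h.1]
    exact ⟨hx, hy⟩
  refine ⟨x, hxu, ?_⟩
  have hlim := (hxt.add hys).sub ((tendsto_iff_norm_sub_tendsto_zero.1 hfx).pow 2)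
  simp only [add_zero, ne_eq, OfNat.ofNat_ne_zero, not_false_eq_true, zero_pow, sub_zero] at hlim
  exact hlim.congr fun n => (h.q_eq (u.dom.sub_mem (hf n) hxu)).symm

theorem IsSum.closable {t s u : PBF H} (h : IsSum t s u) (ht : t.Closable)
    (hs : s.Closable) : u.Closable := by
  obtain ⟨t', htc, htd, hte⟩ := ht
  obtain ⟨s', hsc, hsd, hse⟩ := hs
  have hle : u.dom ≤ t'.dom ⊓ s'.dom := h.1 ▸ inf_le_inf htd hsd
  have hsum := isSum_sum t' s' (u.dense'.mono hle)
  refine ⟨_, hsum.isClosedForm htc hsc, hle, fun x y hx hy => ?_⟩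
  rw [hsum.2 x y (hle hx) (hle hy), h.2 x y hx hy, hte x y (h.mem_left hx) (h.mem_left hy),
    hse x y (h.symm.mem_left hx) (h.symm.mem_left hy)]

theorem OplusDef.exists_oplus {t s : PBF H} (ht : MemAlg Closable t) (hs : MemAlg Closable s)
    (h : OplusDef t s) : ∃ u : PBF H, MemAlg Closable u ∧ Oplus t s u := by
  have hsum := isSum_sum t s (h.dense_inf ht.1 hs.1)
  exact ⟨_, ⟨hsum.inVf h ht.1 hs.1, hsum.closable ht.2 hs.2⟩, h, hsum⟩

theorem IsSum.assoc {t s r u v w : PBF H} (hu : IsSum t s u) (hv : IsSum u r v)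
    (hw : IsSum s r w) : IsSum t w v := by
  have hvw : v.dom = t.dom ⊓ w.dom := by rw [hv.1, hu.1, hw.1, inf_assoc]
  refine ⟨hvw, fun x y hx hy => ?_⟩
  rw [hv.2 x y hx hy, hu.2 x y (hv.mem_left hx) (hv.mem_left hy), add_assoc,
    hw.2 x y (hvw ▸ hx : x ∈ t.dom ⊓ w.dom).2 (hvw ▸ hy : y ∈ t.dom ⊓ w.dom).2]

theorem oplusDef_assoc {t s r u w : PBF H} (ht : t.InVf) (hs : s.InVf) (hr : r.InVf)
    (hts : OplusDef t s) (hur : OplusDef u r) (hu : IsSum t s u) :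
    OplusDef s r ∧ (IsSum s r w → OplusDef t w) := by
  have hud := hu.1
  rcases hts with h | h | h
  · refine ⟨?_, fun _ => .inl h⟩
    rw [ht h, top_inf_eq] at hud
    rcases hur with h' | h' | h'
    · exact .inl (hu.symm.bounded_left h' (ht h ▸ le_top))
    · exact .inr (.inl h')
    · exact .inr (.inr (hud.symm.trans h'))
  · refine ⟨.inl h, fun hw => ?_⟩
    rw [hs h, inf_top_eq] at hud
    rcases hur with h' | h' | h'
    · exact .inl (hu.bounded_left h' (hs h ▸ le_top))
    · exact .inr (.inl (hw.bounded h h'))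
    · refine .inr (.inr ?_)
      rw [hw.1, hs h, top_inf_eq, ← hud, h']
  · rw [h, inf_idem] at hud
    rcases hur with h' | h' | h'
    · exact ⟨.inl (hu.symm.bounded_left h' h.ge), fun _ => .inl (hu.bounded_left h' h.le)⟩
    · refine ⟨.inr (.inl h'), fun hw => .inr (.inr ?_)⟩
      rw [hw.1, hr h', inf_top_eq, h]
    · refine ⟨.inr (.inr (hud.symm.trans h')), fun hw => .inr (.inr ?_)⟩
      rw [hw.1, ← h', hud, inf_idem, h]

theorem bounded_zeroPBF : (zeroPBF H).Bounded := ⟨0, fun _ _ => by simp [zeroPBF]⟩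

theorem isClosedForm_zeroPBF [CompleteSpace H] : (zeroPBF H).IsClosedForm := by
  have hq : ∀ x, (zeroPBF H).q x = ‖x‖ ^ 2 := fun x => by simp [q, zeroPBF]
  intro f _ hc
  have hf : CauchySeq f := Metric.cauchySeq_iff.2 fun ε hε => by
    obtain ⟨N, hN⟩ := hc (ε ^ 2) (pow_pos hε 2)
    refine ⟨N, fun m hm n hn => ?_⟩
    have := hN m hm n hn
    rw [hq] at this
    rw [dist_eq_norm]
    exact lt_of_pow_lt_pow_left₀ 2 hε.le this
  obtain ⟨x, hx⟩ := cauchySeq_tendsto_of_complete hf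
  refine ⟨x, Submodule.mem_top, ?_⟩
  simpa [hq] using (tendsto_iff_norm_sub_tendsto_zero.1 hx).pow 2

theorem oplus_zeroPBF (t : PBF H) : Oplus t (zeroPBF H) t :=
  ⟨.inr (.inl bounded_zeroPBF), inf_top_eq _ |>.symm, fun _ _ _ _ => (add_zero _).symm⟩

/-- Two forms of `𝓥_f(𝓗)` which agree on a dense subspace coincide if each of them is
either bounded or has exactly this subspace as its domain. -/
theorem eq_of_eqOn_dom {t s : PBF H} (ht : t.InVf) (hs : s.InVf) {E : Submodule ℂ H}
    (hE : Dense (E : Set H)) (htE : t.Bounded ∨ t.dom = E) (hsE : s.Bounded ∨ s.dom = E)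
    (h : ∀ x ∈ E, ∀ y ∈ E, t.toFun x y = s.toFun x y) : t = s := by
  have aux : ∀ {a b : PBF H}, a.Bounded → a.InVf → b.dom = E →
      (∀ x ∈ E, ∀ y ∈ E, a.toFun x y = b.toFun x y) → b.Bounded := by
    rintro a b ⟨c, hc⟩ ha hb hab
    refine ⟨c, fun x hx => ?_⟩
    rw [← hab x (hb ▸ hx) x (hb ▸ hx)]
    exact hc x (ha ⟨c, hc⟩ ▸ Submodule.mem_top)
  have main : t.Bounded → s.Bounded → t = s := fun h1 h2 =>
    eq_of_bounded_of_eqOn_dense h1 h2 (ht h1) (hs h2) hE h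
  rcases htE with h1 | h1 <;> rcases hsE with h2 | h2
  · exact main h1 h2
  · exact main h1 (aux h1 ht h2 h)
  · exact main (aux h2 hs h1 fun x hx y hy => (h x hx y hy).symm) h2
  · exact ext_on_dom (h1.trans h2.symm) (h1 ▸ h)

theorem Oplus.cancel {t s r u : PBF H} (ht : t.InVf) (hs : s.InVf) (hr : r.InVf)
    (h1 : Oplus t s u) (h2 : Oplus t r u) : s = r := by
  obtain ⟨hd1, hs1⟩ := h1
  obtain ⟨hd2, hs2⟩ := h2
  have hagree : ∀ x ∈ u.dom, ∀ y ∈ u.dom, s.toFun x y = r.toFun x y := fun x hx y hy =>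
    add_left_cancel ((hs1.2 x y hx hy).symm.trans (hs2.2 x y hx hy))
  have aux : ∀ {a : PBF H}, a.InVf → OplusDef t a → IsSum t a u → a.Bounded ∨ a.dom = u.dom := by
    intro a ha hd h
    rcases hd with hb | hb | hb
    · exact .inr (by rw [h.1, ht hb, top_inf_eq])
    · exact .inl hb
    · exact .inr (by rw [h.1, hb, inf_idem])
  exact eq_of_eqOn_dom hs hr u.dense' (aux hs hd1 hs1) (aux hr hd2 hs2) hagree

theorem IsSum.left_eq_zeroPBF {t s : PBF H} (h : IsSum t s (zeroPBF H)) : t = zeroPBF H := by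
  have htm : ∀ x, x ∈ t.dom := fun x => h.mem_left (Submodule.mem_top : x ∈ (zeroPBF H).dom)
  have hsm : ∀ x, x ∈ s.dom := fun x =>
    h.symm.mem_left (Submodule.mem_top : x ∈ (zeroPBF H).dom)
  refine ext_on_dom (Submodule.eq_top_iff'.2 htm) fun x _ y _ => ?_
  have hx0 : (t.toFun x x).re = 0 := by
    have := congrArg Complex.re (h.2 x x Submodule.mem_top Submodule.mem_top)
    rw [Complex.add_re] at this
    change 0 = _ at this
    linarith [t.re_nonneg x (htm x), s.re_nonneg x (hsm x)]
  have := t.norm_sq_le (htm x) (htm y)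
  rw [hx0, zero_mul] at this
  change t.toFun x y = 0
  exact norm_eq_zero.1 (pow_eq_zero_iff two_ne_zero |>.1 (le_antisymm this (sq_nonneg _)))

end PBF

/-- `(𝓡_f(𝓗); ⊕|_{𝓡_f(𝓗)}, o)`, where `𝓡_f(𝓗)` is the set of regular
(= closable) elements of `𝓥_f(𝓗)`, is a generalized effect algebra; in particular, if
`t, s ∈ 𝓡_f(𝓗)` and `t ⊕ s` is defined in `𝓥_f(𝓗)` then `t ⊕ s` is closable. -/
theorem stmt_3 [CompleteSpace H] (h_inf : ¬ FiniteDimensional ℂ H) :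
    -- the sum of two closable forms of `𝓥_f(𝓗)` is closable, so `⊕|_{𝓡_f}` is defined
    -- whenever `⊕` is
    (∀ t s u : PBF H, t.InVf → s.InVf → t.Closable → s.Closable →
      PBF.Oplus t s u → u.Closable) ∧
    -- `o ∈ 𝓡_f(𝓗)`
    (zeroPBF H).InVf ∧ (zeroPBF H).Closable ∧
    -- single valued
    (∀ t s u v : PBF H, PBF.IsSum t s u → PBF.IsSum t s v → u = v) ∧
    -- well defined into `𝓡_f(𝓗)`
    (∀ t s : PBF H, MemAlg PBF.Closable t → MemAlg PBF.Closable s → PBF.OplusDef t s →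
      ∃ u : PBF H, MemAlg PBF.Closable u ∧ PBF.Oplus t s u) ∧
    -- (GEi) commutativity
    (∀ t s u : PBF H, MemAlg PBF.Closable t → MemAlg PBF.Closable s →
      PBF.Oplus t s u → PBF.Oplus s t u) ∧
    -- (GEii) associativity
    (∀ t s r u v : PBF H, MemAlg PBF.Closable t → MemAlg PBF.Closable s →
      MemAlg PBF.Closable r → MemAlg PBF.Closable u → MemAlg PBF.Closable v →
      PBF.Oplus t s u → PBF.Oplus u r v →
      ∃ w : PBF H, MemAlg PBF.Closable w ∧ PBF.Oplus s r w ∧ PBF.Oplus t w v) ∧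
    -- (GEiii) zero law
    (∀ t : PBF H, MemAlg PBF.Closable t → PBF.Oplus t (zeroPBF H) t) ∧
    -- (GEiv) cancellation
    (∀ t s r u : PBF H, MemAlg PBF.Closable t → MemAlg PBF.Closable s →
      MemAlg PBF.Closable r → PBF.Oplus t s u → PBF.Oplus t r u → s = r) ∧
    -- (GEv) positivity
    (∀ t s : PBF H, MemAlg PBF.Closable t → MemAlg PBF.Closable s →
      PBF.Oplus t s (zeroPBF H) → t = zeroPBF H ∧ s = zeroPBF H) := by
  refine ⟨fun t s u _ _ ht hs h => h.2.closable ht hs, fun _ => rfl,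
    ⟨_, PBF.isClosedForm_zeroPBF, le_rfl, fun _ _ _ _ => rfl⟩,
    fun t s u v hu hv => hu.unique hv, fun t s ht hs h => h.exists_oplus ht hs,
    fun t s u _ _ h => ⟨h.1.symm, h.2.symm⟩, ?_, fun t _ => t.oplus_zeroPBF,
    fun t s r u ht hs hr h1 h2 => h1.cancel ht.1 hs.1 hr.1 h2,
    fun t s _ _ h => ⟨h.2.left_eq_zeroPBF, h.2.symm.left_eq_zeroPBF⟩⟩
  intro t s r u v ht hs hr _ _ htsu hurv
  have hd := fun w => PBF.oplusDef_assoc (w := w) ht.1 hs.1 hr.1 htsu.1 hurv.1 htsu.2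
  obtain ⟨w, hw, hsrw⟩ := (hd u).1.exists_oplus hs hr
  exact ⟨w, hw, hsrw, (hd w).2 hsrw.2, htsu.2.assoc hurv.2 hsrw.2⟩
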